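/- Let G be a simple graph on vertices x_1,...,x_n and L(G) the graph obtained by adding a loop at every vertex, with edge ideal I(L(G)). Then I(L(G))^k has a linear resolution for all k >= 1 if and only if G is complete, and index(I(L(G))^k) = 1 for all k >= 1 if and only if G is not complete. -/

import Mathlib

open MvPolynomial

noncomputable section

abbrev SRing (K : Type) [Field K] (n : ℕ) := MvPolynomial (Fin n) K

/-- total degree of an exponent vector -/
def mdeg {n : ℕ} (e : Fin n →₀ ℕ) : ℕ := e.sum fun _ v => v

/-- minimal monomial generators of a monomial ideal, as exponent vectors:
monomials in `J` none of whose proper divisors lies in `J` -/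
def minGen {K : Type} [Field K] {n : ℕ} (J : Ideal (SRing K n)) : Set (Fin n →₀ ℕ) :=
  {e | (monomial e (1:K)) ∈ J ∧
    ∀ e' : Fin n →₀ ℕ, e' ≤ e → e' ≠ e → (monomial e' (1:K)) ∉ J}

/-- adjacency in the graph `G_J^{(u,v)}` : vertices are the minimal generators of `J`
dividing `lcm(u,v)`, with an edge between two of them iff their lcm has degree `d+1` -/
def lcmGraphAdj {K : Type} [Field K] {n : ℕ} (J : Ideal (SRing K n)) (d : ℕ)
    (u v : Fin n →₀ ℕ) (w w' : Fin n →₀ ℕ) : Prop :=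
  w ∈ minGen J ∧ w' ∈ minGen J ∧ w ≤ u ⊔ v ∧ w' ≤ u ⊔ v ∧ mdeg (w ⊔ w') = d + 1

/-- a graded partial free resolution of the ideal `I`, exact at homological positions `< r`:
`F_i` is free with basis in (internal) degrees `dg i`, the maps are graded of degree `0`,
`F_0` surjects onto `I`, and the sequence is exact at `F_i` for `i < r`. -/
structure GradedPartialRes {K : Type} [Field K] {n : ℕ} (I : Ideal (SRing K n)) (r : ℕ∞) where
  s : ℕ → ℕ
  dg : ∀ i, Fin (s i) → ℕ
  aug : (Fin (s 0) →₀ SRing K n) →ₗ[SRing K n] SRing K n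
  diff : ∀ i, (Fin (s (i+1)) →₀ SRing K n) →ₗ[SRing K n] (Fin (s i) →₀ SRing K n)
  aug_hom : ∀ k, (aug (Finsupp.single k 1)).IsHomogeneous (dg 0 k)
  diff_hom : ∀ i k l, (diff i (Finsupp.single k 1)) l = 0 ∨
      ∃ m, ((diff i (Finsupp.single k 1)) l).IsHomogeneous m ∧ dg i l + m = dg (i+1) k
  aug_range : LinearMap.range aug = I
  exact_zero : (0 : ℕ∞) < r → LinearMap.range (diff 0) = LinearMap.ker aug
  exact_succ : ∀ i : ℕ, ((i : ℕ∞) + 1) < r →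
      LinearMap.range (diff (i+1)) = LinearMap.ker (diff i)

/-- the graded Betti number `β_{i,j}(I)`: the minimal number of degree-`j` basis elements
in homological position `i`, over all graded partial resolutions of `I` exact at
positions `0, …, i` (the minimum is attained by the minimal graded free resolution). -/
def gradedBetti {K : Type} [Field K] {n : ℕ} (I : Ideal (SRing K n)) (i j : ℕ) : ℕ∞ :=
  ⨅ R : GradedPartialRes I ((i : ℕ∞)+1),
    ((Finset.univ.filter fun k => R.dg i k = j).card : ℕ∞)

/-- `I` (generated in degree `d`) is `r` steps linear: `β_{i,i+j}(I) = 0` for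
all `i ≤ r` and `j > d` -/
def stepsLinear {K : Type} [Field K] {n : ℕ} (I : Ideal (SRing K n)) (d r : ℕ) : Prop :=
  ∀ i ≤ r, ∀ j, d < j → gradedBetti I i (i+j) = 0

/-- `index(I) = sup{r : I is r steps linear} + 1` -/
def idealIndex {K : Type} [Field K] {n : ℕ} (I : Ideal (SRing K n)) (d : ℕ) : ℕ∞ :=
  sSup {x : ℕ∞ | ∃ r : ℕ, x = (r : ℕ∞) + 1 ∧ stepsLinear I d r}

/-- `I` is linearly related: all first syzygies are linear, i.e. `index(I) > 1` -/
def LinearlyRelated {K : Type} [Field K] {n : ℕ} (I : Ideal (SRing K n)) (d : ℕ) : Prop :=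
  stepsLinear I d 1

/-- projective dimension of `I`: the minimal length of a graded free resolution of `I` -/
def projDim {K : Type} [Field K] {n : ℕ} (I : Ideal (SRing K n)) : ℕ∞ :=
  sInf {x : ℕ∞ | ∃ m : ℕ, x = (m : ℕ∞) ∧
    ∃ R : GradedPartialRes I ⊤, ∀ i : ℕ, m < i → R.s i = 0}

/-- the edge ideal of the graph (possibly with loops) given by a symmetric relation `E`:
generated by the monomials `X i * X j` with `E i j` -/
def edgeIdeal (K : Type) [Field K] {n : ℕ} (E : Fin n → Fin n → Prop) : Ideal (SRing K n) :=
  Ideal.span {p | ∃ i j, E i j ∧ p = X i * X j}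

/-- `E` is gap free: for any two disjoint edges there is an edge meeting both -/
def GapFree {n : ℕ} (E : Fin n → Fin n → Prop) : Prop :=
  ∀ i i' j j', E i i' → E j j' → i ≠ j → i ≠ j' → i' ≠ j → i' ≠ j' →
    ∃ a b, E a b ∧ (a = i ∨ a = i') ∧ (b = j ∨ b = j')

section Lin

variable {K : Type} [Field K] {n : ℕ}

lemma coeff_mul_ne_zero {p q : SRing K n} {e : Fin n →₀ ℕ} (h : coeff e (p * q) ≠ 0) :
    ∃ u v, u + v = e ∧ coeff u p ≠ 0 ∧ coeff v q ≠ 0 := by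
  classical
  rw [coeff_mul] at h
  obtain ⟨x, hx, hne⟩ := Finset.exists_ne_zero_of_sum_ne_zero h
  exact ⟨x.1, x.2, Finset.HasAntidiagonal.mem_antidiagonal.1 hx, left_ne_zero_of_mul hne,
    right_ne_zero_of_mul hne⟩

lemma degree_eq_of_coeff_ne_zero {p : SRing K n} {m : ℕ} (hp : p.IsHomogeneous m)
    {e : Fin n →₀ ℕ} (he : coeff e p ≠ 0) : e.degree = m := by
  by_contra h
  exact he (hp.coeff_eq_zero h)

lemma isHomogeneous_of_degree {p : SRing K n} {m : ℕ}
    (h : ∀ e, coeff e p ≠ 0 → e.degree = m) : p.IsHomogeneous m := by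
  intro e he
  rw [← h e he, Finsupp.degree_eq_weight_one]
  rfl

/-- A family of additive subgroups of a module over the polynomial ring, indexed by degree and
compatible with multiplication by homogeneous polynomials. -/
structure GradedPieces (K : Type) [Field K] (n : ℕ) (M : Type) [AddCommGroup M]
    [Module (SRing K n) M] where
  piece : ℕ → AddSubgroup M
  smul_mem : ∀ {m N : ℕ} {p : SRing K n} {x : M}, p.IsHomogeneous m → x ∈ piece N →
    p • x ∈ piece (m + N)

namespace GradedPieces

/-- The grading of a free module whose basis elements have the prescribed degrees. -/
def free {ι : Type} (dg : ι → ℕ) : GradedPieces K n (ι → SRing K n) where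
  piece N :=
    { carrier := {f | ∀ l e, coeff e (f l) ≠ 0 → dg l + e.degree = N}
      zero_mem' := by intro l e h; simp at h
      add_mem' := by
        intro f g hf hg l e h
        by_cases h1 : coeff e (f l) = 0
        · exact hg l e (by simpa [h1] using h)
        · exact hf l e h1
      neg_mem' := by
        intro f hf l e h
        exact hf l e (by simpa using h) }
  smul_mem := by
    intro m N p f hp hf l e h
    obtain ⟨u, v, rfl, hu, hv⟩ := coeff_mul_ne_zero (p := p) (q := f l) h
    have h1 := degree_eq_of_coeff_ne_zero hp hu
    have h2 := hf l v hv
    rw [map_add]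
    omega

lemma mem_free {ι : Type} {dg : ι → ℕ} {N : ℕ} {f : ι → SRing K n} :
    f ∈ (free dg).piece N ↔ ∀ l e, coeff e (f l) ≠ 0 → dg l + e.degree = N := Iff.rfl

/-- The grading of the polynomial ring by total degree. -/
def ring (K : Type) [Field K] (n : ℕ) : GradedPieces K n (SRing K n) where
  piece N := (homogeneousSubmodule (Fin n) K N).toAddSubgroup
  smul_mem := fun hp hx => IsHomogeneous.mul hp hx

variable {M M' : Type} [AddCommGroup M] [Module (SRing K n) M]
  [AddCommGroup M'] [Module (SRing K n) M']

/-- The grading induced on a submodule. -/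
def restrict (𝒜 : GradedPieces K n M) (L : Submodule (SRing K n) M) : GradedPieces K n L where
  piece N := (𝒜.piece N).comap L.subtype.toAddMonoidHom
  smul_mem := fun hp hx => 𝒜.smul_mem hp hx

lemma mem_restrict {𝒜 : GradedPieces K n M} {L : Submodule (SRing K n) M} {N : ℕ} {x : L} :
    x ∈ (𝒜.restrict L).piece N ↔ (x : M) ∈ 𝒜.piece N := Iff.rfl

/-- The grading of a direct sum. -/
def prod (𝒜 : GradedPieces K n M) (ℬ : GradedPieces K n M') : GradedPieces K n (M × M') where
  piece N := (𝒜.piece N).prod (ℬ.piece N)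
  smul_mem := fun hp hx => ⟨𝒜.smul_mem hp hx.1, ℬ.smul_mem hp hx.2⟩

/-- The grading shifted up by one degree. -/
def shift (𝒜 : GradedPieces K n M) : GradedPieces K n M where
  piece
    | 0 => ⊥
    | N + 1 => 𝒜.piece N
  smul_mem := by
    rintro m (_ | N) p x hp hx
    · obtain rfl : x = 0 := hx
      rw [smul_zero]
      exact zero_mem _
    · exact 𝒜.smul_mem hp hx

lemma shift_free {ι : Type} (dg : ι → ℕ) :
    (free dg : GradedPieces K n _).shift = free fun k => dg k + 1 := by
  unfold shift
  congr 1
  funext N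
  ext f
  cases N with
  | zero =>
    rw [AddSubgroup.mem_bot]
    change f = 0 ↔ ∀ l e, coeff e (f l) ≠ 0 → dg l + 1 + e.degree = 0
    constructor
    · rintro rfl l e h
      simp at h
    · intro h
      ext l e
      by_contra he
      have := h l e (by simpa using he)
      omega
  | succ N =>
    simp only [mem_free]
    refine forall₂_congr fun l e => imp_congr_right fun _ => ?_
    omega

lemma shift_restrict (𝒜 : GradedPieces K n M) (L : Submodule (SRing K n) M) :
    (𝒜.restrict L).shift = 𝒜.shift.restrict L := by
  unfold shift restrict
  congr 1
  funext N
  ext x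
  cases N with
  | zero => simp
  | succ N => rfl

end GradedPieces

open GradedPieces

/-- A graded module has `r` steps of a free resolution whose `i`-th term is generated in
degrees at most `d + i`. -/
def Lin : ℕ → ℕ → ∀ {M : Type} [AddCommGroup M] [Module (SRing K n) M], GradedPieces K n M → Prop
  | 0, _, _, _, _, _ => True
  | r + 1, d, M, _, _, 𝒜 =>
    ∃ (ι : Type) (_ : Fintype ι) (dg : ι → ℕ) (φ : (ι → SRing K n) →ₗ[SRing K n] M),
      (∀ k, dg k ≤ d) ∧ Function.Surjective φ ∧
      (∀ N, ∀ f ∈ (free dg).piece N, φ f ∈ 𝒜.piece N) ∧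
      (∀ N, ∀ x ∈ 𝒜.piece N, ∃ f ∈ (free dg).piece N, φ f = x) ∧
      Lin r (d + 1) ((free dg).restrict (LinearMap.ker φ))

section

variable {A B C : Type} [AddCommGroup A] [Module (SRing K n) A]
  [AddCommGroup B] [Module (SRing K n) B] [AddCommGroup C] [Module (SRing K n) C]

lemma Lin.mono_steps {r : ℕ} : ∀ {d : ℕ} {M : Type} [AddCommGroup M] [Module (SRing K n) M]
    {𝒜 : GradedPieces K n M}, Lin (r + 1) d 𝒜 → Lin r d 𝒜 := by
  induction r with
  | zero => intros; trivial
  | succ r ih =>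
    rintro d M _ _ 𝒜 ⟨ι, hι, dg, φ, h1, h2, h3, h4, h5⟩
    exact ⟨ι, hι, dg, φ, h1, h2, h3, h4, ih h5⟩

lemma Lin.shift {r : ℕ} : ∀ {d : ℕ} {M : Type} [AddCommGroup M] [Module (SRing K n) M]
    {𝒜 : GradedPieces K n M}, Lin r d 𝒜 → Lin r (d + 1) 𝒜.shift := by
  induction r with
  | zero => intros; trivial
  | succ r ih =>
    rintro d M _ _ 𝒜 ⟨ι, hι, dg, φ, h1, h2, h3, h4, h5⟩
    have h5' := ih h5
    rw [shift_restrict, shift_free] at h5'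
    refine ⟨ι, hι, fun k => dg k + 1, φ, fun k => Nat.succ_le_succ (h1 k), h2, ?_, ?_, h5'⟩
    · rw [← shift_free]
      rintro (_ | N) f hf
      · obtain rfl : f = 0 := hf
        rw [map_zero]
        exact zero_mem _
      · exact h3 N f hf
    · rw [← shift_free]
      rintro (_ | N) x hx
      · obtain rfl : x = 0 := hx
        exact ⟨0, zero_mem _, map_zero _⟩
      · exact h4 N x hx

lemma Lin.of_subsingleton {r : ℕ} : ∀ {d : ℕ} {M : Type} [AddCommGroup M]
    [Module (SRing K n) M] [Subsingleton M] (𝒜 : GradedPieces K n M), Lin r d 𝒜 := by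
  induction r with
  | zero => intros; trivial
  | succ r ih =>
    intro d M _ _ _ 𝒜
    refine ⟨Empty, inferInstance, fun k => k.elim, 0, fun k => k.elim,
      fun x => ⟨0, Subsingleton.elim _ _⟩, fun N f _ => ?_,
      fun N x _ => ⟨0, zero_mem _, Subsingleton.elim _ _⟩, ih _⟩
    rw [LinearMap.zero_apply]
    exact zero_mem _

/-- A short exact sequence of graded modules, exact in every degree. -/
structure GradedSES (𝒜 : GradedPieces K n A) (ℬ : GradedPieces K n B) (𝒞 : GradedPieces K n C)
    (f : A →ₗ[SRing K n] B) (g : B →ₗ[SRing K n] C) : Prop where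
  inj : Function.Injective f
  surj : Function.Surjective g
  exact : ∀ b, g b = 0 ↔ ∃ a, f a = b
  mem_iff : ∀ N a, f a ∈ ℬ.piece N ↔ a ∈ 𝒜.piece N
  map_mem : ∀ N, ∀ b ∈ ℬ.piece N, g b ∈ 𝒞.piece N
  lift : ∀ N, ∀ c ∈ 𝒞.piece N, ∃ b ∈ ℬ.piece N, g b = c

lemma mem_free_sum {ι κ : Type} {dA : ι → ℕ} {dC : κ → ℕ} {N : ℕ} {v : ι ⊕ κ → SRing K n} :
    v ∈ (free (Sum.elim dA dC)).piece N ↔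
      (fun i => v (Sum.inl i)) ∈ (free dA).piece N ∧
      (fun k => v (Sum.inr k)) ∈ (free dC).piece N := by
  simp only [mem_free, Sum.forall, Sum.elim_inl, Sum.elim_inr]

lemma single_mem_free {ι : Type} [DecidableEq ι] (dg : ι → ℕ) (k : ι) :
    Pi.single k (1 : SRing K n) ∈ (free dg).piece (dg k) := by
  classical
  intro l e h
  by_cases hl : l = k
  · subst hl
    rw [Pi.single_eq_same, coeff_one] at h
    have : e = 0 := by
      by_contra hne
      exact h (if_neg (Ne.symm hne))
    simp [this]
  · rw [Pi.single_eq_of_ne hl] at h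
    simp at h

lemma linearCombination_mem {κ : Type} [Fintype κ] {dg : κ → ℕ} {ℬ : GradedPieces K n B}
    {β : κ → B} (hβ : ∀ k, β k ∈ ℬ.piece (dg k)) {N : ℕ} {v : κ → SRing K n}
    (hv : v ∈ (free dg).piece N) : Fintype.linearCombination (SRing K n) β v ∈ ℬ.piece N := by
  rw [Fintype.linearCombination_apply]
  refine sum_mem fun k _ => ?_
  by_cases h0 : v k = 0
  · rw [h0, zero_smul]
    exact zero_mem _
  obtain ⟨e, he⟩ := exists_coeff_ne_zero h0
  have hN := hv k e he
  have hhom : (v k).IsHomogeneous e.degree := isHomogeneous_of_degree fun e' he' => by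
    have := hv k e' he'
    omega
  have := ℬ.smul_mem hhom (hβ k)
  rwa [add_comm, hN] at this

lemma GradedSES.lin_middle {r : ℕ} : ∀ {d : ℕ} {A B C : Type}
    [AddCommGroup A] [Module (SRing K n) A] [AddCommGroup B] [Module (SRing K n) B]
    [AddCommGroup C] [Module (SRing K n) C] {𝒜 : GradedPieces K n A} {ℬ : GradedPieces K n B}
    {𝒞 : GradedPieces K n C} {f : A →ₗ[SRing K n] B} {g : B →ₗ[SRing K n] C},
    GradedSES 𝒜 ℬ 𝒞 f g → Lin r d 𝒜 → Lin r d 𝒞 → Lin r d ℬ := by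
  induction r with
  | zero => intros; trivial
  | succ r ih =>
    classical
    rintro d A B C _ _ _ _ _ _ 𝒜 ℬ 𝒞 f g S ⟨ι, hι, dA, φA, a1, a2, a3, a4, a5⟩
      ⟨κ, hκ, dC, φC, c1, c2, c3, c4, c5⟩
    choose β hβ hβg using fun k => S.lift _ _ (c3 _ _ (single_mem_free dC k))
    let pA : (ι ⊕ κ → SRing K n) →ₗ[SRing K n] (ι → SRing K n) :=
      LinearMap.funLeft _ _ Sum.inl
    let pC : (ι ⊕ κ → SRing K n) →ₗ[SRing K n] (κ → SRing K n) :=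
      LinearMap.funLeft _ _ Sum.inr
    let L : (κ → SRing K n) →ₗ[SRing K n] B := Fintype.linearCombination _ β
    have hL : ∀ v, g (L v) = φC v := by
      intro v
      have : g ∘ₗ L = φC := by
        refine LinearMap.pi_ext' fun k => LinearMap.ext_ring ?_
        simp [L, hβg]
      exact LinearMap.congr_fun this v
    have hLmem : ∀ N, ∀ v ∈ (free dC).piece N, L v ∈ ℬ.piece N :=
      fun N v hv => linearCombination_mem hβ hv
    let φ : (ι ⊕ κ → SRing K n) →ₗ[SRing K n] B := f ∘ₗ φA ∘ₗ pA + L ∘ₗ pC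
    have hφ : ∀ v, φ v = f (φA (pA v)) + L (pC v) := fun v => rfl
    have hgf : ∀ a, g (f a) = 0 := fun a => (S.exact _).2 ⟨a, rfl⟩
    have hgφ : ∀ v, g (φ v) = φC (pC v) := fun v => by rw [hφ, map_add, hgf, zero_add, hL]
    let jj : (ι → SRing K n) →ₗ[SRing K n] (ι ⊕ κ → SRing K n) :=
      { toFun := fun v => Sum.elim v 0
        map_add' := by intro v w; ext (i | i) <;> simp
        map_smul' := by intro p v; ext (i | i) <;> simp }
    have hpAj : ∀ v, pA (jj v) = v := fun v => rfl
    have hpCj : ∀ v, pC (jj v) = 0 := fun v => rfl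
    have hmem : ∀ {N v}, v ∈ (free (Sum.elim dA dC)).piece N ↔
      pA v ∈ (free dA).piece N ∧ pC v ∈ (free dC).piece N := mem_free_sum
    refine ⟨ι ⊕ κ, inferInstance, Sum.elim dA dC, φ, ?_, ?_, ?_, ?_, ?_⟩
    · rintro (k | k)
      exacts [a1 k, c1 k]
    · intro b
      obtain ⟨w, hw⟩ := c2 (g b)
      obtain ⟨a, ha⟩ := (S.exact (b - L w)).1 (by rw [map_sub, hL, hw, sub_self])
      obtain ⟨v, hv⟩ := a2 a
      refine ⟨Sum.elim v w, ?_⟩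
      rw [hφ]
      change f (φA v) + L w = b
      rw [hv, ha, sub_add_cancel]
    · intro N v hv
      obtain ⟨h1, h2⟩ := hmem.1 hv
      rw [hφ]
      exact add_mem ((S.mem_iff _ _).2 (a3 _ _ h1)) (hLmem _ _ h2)
    · intro N b hb
      obtain ⟨w, hwm, hw⟩ := c4 N (g b) (S.map_mem _ _ hb)
      obtain ⟨a, ha⟩ := (S.exact (b - L w)).1 (by rw [map_sub, hL, hw, sub_self])
      have ham : a ∈ 𝒜.piece N := by
        rw [← S.mem_iff, ha]
        exact sub_mem hb (hLmem _ _ hwm)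
      obtain ⟨v, hvm, hv⟩ := a4 N a ham
      refine ⟨Sum.elim v w, hmem.2 ⟨hvm, hwm⟩, ?_⟩
      rw [hφ]
      change f (φA v) + L w = b
      rw [hv, ha, sub_add_cancel]
    · have hj : ∀ x ∈ LinearMap.ker φA, jj x ∈ LinearMap.ker φ := by
        intro x hx
        rw [LinearMap.mem_ker] at hx ⊢
        rw [hφ, hpAj, hpCj, hx, map_zero, map_zero, add_zero]
      have hp : ∀ x ∈ LinearMap.ker φ, pC x ∈ LinearMap.ker φC := by
        intro x hx
        rw [LinearMap.mem_ker] at hx ⊢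
        rw [← hgφ, hx, map_zero]
      have key : ∀ w ∈ LinearMap.ker φC, ∃ a, f a = - L w := by
        intro w hw
        exact (S.exact _).1 (by rw [map_neg, hL, LinearMap.mem_ker.1 hw, neg_zero])
      refine ih (f := jj.restrict hj) (g := pC.restrict hp)
        ⟨?_, ?_, ?_, ?_, ?_, ?_⟩ a5 c5
      · intro x y hxy
        have h := congrArg (fun z => pA z.1) hxy
        exact Subtype.ext h
      · rintro ⟨w, hw⟩
        obtain ⟨a, ha⟩ := key w hw
        obtain ⟨v, hv⟩ := a2 a
        refine ⟨⟨Sum.elim v w, ?_⟩, rfl⟩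
        rw [LinearMap.mem_ker, hφ]
        change f (φA v) + L w = 0
        rw [hv, ha, neg_add_cancel]
      · rintro ⟨v, hv⟩
        constructor
        · intro h
          have h0 : pC v = 0 := congrArg Subtype.val h
          rw [LinearMap.mem_ker, hφ, h0, map_zero, add_zero] at hv
          have hv' : φA (pA v) = 0 := S.inj (by rw [hv, map_zero])
          refine ⟨⟨pA v, hv'⟩, Subtype.ext ?_⟩
          funext x
          rcases x with x | x
          · rfl
          · exact (congrFun h0 x).symm
        · rintro ⟨a, ha⟩
          refine Subtype.ext ?_
          exact (congrArg (fun z => pC z.1) ha).symm.trans (hpCj _)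
      · intro N x
        rw [mem_restrict, mem_restrict, hmem]
        refine ⟨fun h => h.1, fun h => ⟨h, ?_⟩⟩
        exact zero_mem _
      · intro N x hx
        exact (hmem.1 hx).2
      · rintro N ⟨w, hw⟩ hwm
        obtain ⟨a, ha⟩ := key w hw
        have ham : a ∈ 𝒜.piece N := by
          rw [← S.mem_iff, ha]
          exact neg_mem (hLmem _ _ hwm)
        obtain ⟨v, hvm, hv⟩ := a4 N a ham
        refine ⟨⟨Sum.elim v w, ?_⟩, hmem.2 ⟨hvm, hwm⟩, rfl⟩
        rw [LinearMap.mem_ker, hφ]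
        change f (φA v) + L w = 0
        rw [hv, ha, neg_add_cancel]

lemma GradedSES.lin_right {𝒜 : GradedPieces K n A} {ℬ : GradedPieces K n B}
    {𝒞 : GradedPieces K n C} {f : A →ₗ[SRing K n] B} {g : B →ₗ[SRing K n] C}
    (S : GradedSES 𝒜 ℬ 𝒞 f g) {r d : ℕ} (hA : Lin r (d + 1) 𝒜) (hB : Lin r d ℬ) :
    Lin r d 𝒞 := by
  cases r with
  | zero => trivial
  | succ r =>
    obtain ⟨ι, hι, dg, φ, h1, h2, h3, h4, h5⟩ := hB
    refine ⟨ι, hι, dg, g ∘ₗ φ, h1, S.surj.comp h2, fun N v hv => S.map_mem _ _ (h3 _ _ hv),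
      ?_, ?_⟩
    · intro N c hc
      obtain ⟨b, hb, rfl⟩ := S.lift N c hc
      obtain ⟨v, hv, rfl⟩ := h4 N b hb
      exact ⟨v, hv, rfl⟩
    · have hle : LinearMap.ker φ ≤ LinearMap.ker (g ∘ₗ φ) := LinearMap.ker_le_ker_comp _ _
      have hr : ∀ x : LinearMap.ker (g ∘ₗ φ), φ x ∈ LinearMap.range f :=
        fun x => (S.exact _).1 x.2
      let q : LinearMap.ker (g ∘ₗ φ) →ₗ[SRing K n] A :=
        (LinearEquiv.ofInjective f S.inj).symm.toLinearMap ∘ₗ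
          (φ ∘ₗ (LinearMap.ker (g ∘ₗ φ)).subtype).codRestrict (LinearMap.range f) hr
      have hq : ∀ x, f (q x) = φ x := by
        intro x
        have := LinearEquiv.apply_symm_apply (LinearEquiv.ofInjective f S.inj) ⟨φ x, hr x⟩
        exact congrArg Subtype.val this
      have hgf : ∀ a v, φ v = f a → v ∈ LinearMap.ker (g ∘ₗ φ) := by
        intro a v h
        rw [LinearMap.mem_ker, LinearMap.comp_apply, h]
        exact (S.exact _).2 ⟨a, rfl⟩
      refine GradedSES.lin_middle (f := Submodule.inclusion hle) (g := q)
        ⟨Submodule.inclusion_injective hle, ?_, ?_, ?_, ?_, ?_⟩ h5 hA.mono_steps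
      · intro a
        obtain ⟨v, hv⟩ := h2 (f a)
        exact ⟨⟨v, hgf a v hv⟩, S.inj (by rw [hq, hv])⟩
      · intro x
        constructor
        · intro h
          have hx := hq x
          rw [h, map_zero] at hx
          exact ⟨⟨x, hx.symm⟩, rfl⟩
        · rintro ⟨a, rfl⟩
          refine S.inj ?_
          rw [hq, map_zero]
          exact a.2
      · exact fun N a => Iff.rfl
      · intro N x hx
        rw [← S.mem_iff, hq]
        exact h3 _ _ hx
      · intro N a ha
        obtain ⟨v, hv, hva⟩ := h4 N (f a) ((S.mem_iff _ _).2 ha)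
        exact ⟨⟨v, hgf a v hva⟩, hv, S.inj (by rw [hq, hva])⟩

lemma Lin.prod {𝒜 : GradedPieces K n A} {ℬ : GradedPieces K n B} {r d : ℕ}
    (hA : Lin r d 𝒜) (hB : Lin r d ℬ) : Lin r d (𝒜.prod ℬ) := by
  refine GradedSES.lin_middle (f := LinearMap.inl _ A B) (g := LinearMap.snd _ A B)
    ⟨LinearMap.inl_injective, LinearMap.snd_surjective, ?_, ?_, ?_, ?_⟩ hA hB
  · rintro ⟨a, b⟩
    constructor
    · rintro rfl
      exact ⟨a, rfl⟩
    · rintro ⟨a', h⟩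
      exact (congrArg Prod.snd h).symm
  · exact fun N a => ⟨fun h => h.1, fun h => ⟨h, zero_mem _⟩⟩
  · exact fun N b hb => hb.2
  · exact fun N b hb => ⟨(0, b), ⟨zero_mem _, hb⟩, rfl⟩

end

end Lin

section OrderIdeal

variable {K : Type} [Field K] {n : ℕ}

open GradedPieces

/-- The ideal of polynomials all of whose monomials have order at least `d` with respect to a
superadditive order function on exponents. -/
def orderIdeal (K : Type) [Field K] {n : ℕ} (v : (Fin n →₀ ℕ) → ℕ)
    (hv : ∀ u w, v u + v w ≤ v (u + w)) (d : ℕ) : Ideal (SRing K n) where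
  carrier := {p | ∀ e, coeff e p ≠ 0 → d ≤ v e}
  zero_mem' := by intro e h; simp at h
  add_mem' := by
    intro p q hp hq e h
    by_cases h1 : coeff e p = 0
    · exact hq e (by simpa [h1] using h)
    · exact hp e h1
  smul_mem' := by
    intro p q hq e h
    obtain ⟨u, w, rfl, -, hw⟩ := coeff_mul_ne_zero h
    have := hq w hw
    have := hv u w
    omega

lemma mem_orderIdeal {v : (Fin n →₀ ℕ) → ℕ} {hv : ∀ u w, v u + v w ≤ v (u + w)} {d : ℕ}
    {p : SRing K n} : p ∈ orderIdeal K v hv d ↔ ∀ e, coeff e p ≠ 0 → d ≤ v e := Iff.rfl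

lemma pow_le_orderIdeal {v : (Fin n →₀ ℕ) → ℕ} {hv : ∀ u w, v u + v w ≤ v (u + w)}
    {I : Ideal (SRing K n)} (hI : I ≤ orderIdeal K v hv 1) (k : ℕ) :
    I ^ k ≤ orderIdeal K v hv k := by
  induction k with
  | zero => intro p _ e _; exact Nat.zero_le _
  | succ k ih =>
    rw [pow_succ, Ideal.mul_le]
    intro p hp q hq e h
    obtain ⟨u, w, rfl, hu, hw⟩ := coeff_mul_ne_zero h
    have := ih hp u hu
    have := hI hq w hw
    have := hv u w
    omega

/-- The `d`-th power of the ideal generated by a set of variables. -/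
def varPow (K : Type) [Field K] {n : ℕ} (s : Finset (Fin n)) (d : ℕ) : Ideal (SRing K n) :=
  orderIdeal K (fun e => ∑ j ∈ s, e j)
    (fun u w => by simp [Finset.sum_add_distrib]) d

lemma mem_varPow {s : Finset (Fin n)} {d : ℕ} {p : SRing K n} :
    p ∈ varPow K s d ↔ ∀ e, coeff e p ≠ 0 → d ≤ ∑ j ∈ s, e j := Iff.rfl

lemma coeff_add_single_X_mul (a : Fin n) (e : Fin n →₀ ℕ) (p : SRing K n) :
    coeff (e + Finsupp.single a 1) (X a * p) = coeff e p := by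
  rw [add_comm, coeff_X_mul]

lemma coeff_X_mul_ne_zero {a : Fin n} {e : Fin n →₀ ℕ} {p : SRing K n}
    (h : coeff e (X a * p) ≠ 0) : ∃ u, u + Finsupp.single a 1 = e ∧ coeff u p ≠ 0 := by
  obtain ⟨u, w, rfl, hu, hw⟩ := coeff_mul_ne_zero h
  rw [coeff_X] at hu
  have : Finsupp.single a 1 = u := by
    by_contra hne
    exact hu (if_neg hne)
  exact ⟨w, by rw [← this, add_comm], hw⟩

section Insert

variable {a : Fin n} {s : Finset (Fin n)} {d : ℕ}

lemma sum_add_single (u : Fin n →₀ ℕ) (t : Finset (Fin n)) :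
    ∑ j ∈ t, (u + Finsupp.single a 1 : Fin n →₀ ℕ) j = ∑ j ∈ t, u j + if a ∈ t then 1 else 0 := by
  classical
  simp [Finset.sum_add_distrib, Finsupp.single_apply]

lemma varPow_le_insert (p : SRing K n) (h : p ∈ varPow K s (d + 1)) :
    p ∈ varPow K (insert a s) (d + 1) := fun e he =>
  (h e he).trans (Finset.sum_le_sum_of_subset (Finset.subset_insert _ _))

lemma varPow_succ_le (p : SRing K n) (h : p ∈ varPow K s (d + 1)) : p ∈ varPow K s d :=
  fun e he => (Nat.le_succ d).trans (h e he)

lemma X_mul_mem_insert (p : SRing K n) (h : p ∈ varPow K (insert a s) d) :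
    X a * p ∈ varPow K (insert a s) (d + 1) := by
  refine mem_varPow.2 fun e he => ?_
  obtain ⟨u, rfl, hu⟩ := coeff_X_mul_ne_zero he
  have := mem_varPow.1 h u hu
  rw [sum_add_single, if_pos (Finset.mem_insert_self _ _)]
  omega

lemma mem_of_X_mul_mem (ha : a ∉ s) (p : SRing K n) (h : X a * p ∈ varPow K s d) :
    p ∈ varPow K s d := by
  refine mem_varPow.2 fun e he => ?_
  have := mem_varPow.1 h (e + Finsupp.single a 1) (by rwa [coeff_add_single_X_mul])
  rwa [sum_add_single, if_neg ha, add_zero] at this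

lemma modMonomial_mem_varPow (ha : a ∉ s) {p : SRing K n} (h : p ∈ varPow K (insert a s) d) :
    modMonomial p (Finsupp.single a 1) ∈ varPow K s d := by
  refine mem_varPow.2 fun e he => ?_
  by_cases hle : Finsupp.single a 1 ≤ e
  · exact absurd (coeff_modMonomial_of_le _ hle) he
  · rw [coeff_modMonomial_of_not_le _ hle] at he
    have := mem_varPow.1 h e he
    rw [Finsupp.single_le_iff] at hle
    rw [Finset.sum_insert ha] at this
    omega

lemma divMonomial_mem_varPow {p : SRing K n} (h : p ∈ varPow K (insert a s) (d + 1)) :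
    divMonomial p (Finsupp.single a 1) ∈ varPow K (insert a s) d := by
  refine mem_varPow.2 fun e he => ?_
  rw [coeff_divMonomial, add_comm] at he
  have := mem_varPow.1 h _ he
  rw [sum_add_single, if_pos (Finset.mem_insert_self _ _)] at this
  omega

lemma modMonomial_isHomogeneous {p : SRing K n} {N : ℕ} (h : p.IsHomogeneous N) :
    (modMonomial p (Finsupp.single a 1)).IsHomogeneous N := by
  refine isHomogeneous_of_degree fun e he => degree_eq_of_coeff_ne_zero h (e := e) ?_
  by_cases hle : Finsupp.single a 1 ≤ e
  · exact absurd (coeff_modMonomial_of_le _ hle) he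
  · rwa [coeff_modMonomial_of_not_le _ hle] at he

lemma degree_of_coeff_divMonomial_ne_zero {p : SRing K n} {N : ℕ} (h : p.IsHomogeneous N)
    {e : Fin n →₀ ℕ} (he : coeff e (divMonomial p (Finsupp.single a 1)) ≠ 0) : e.degree + 1 = N := by
  rw [coeff_divMonomial] at he
  have := degree_eq_of_coeff_ne_zero h he
  rw [map_add, Finsupp.degree_single] at this
  omega

/-- The first map in the short exact sequence
`0 → P_s^(d+1)(-1) → P_s^(d+1) ⊕ P_t^d(-1) → P_t^(d+1) → 0` where `t = s ∪ {a}`. -/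
def insertInl (K : Type) [Field K] (a : Fin n) (s : Finset (Fin n)) (d : ℕ) :
    varPow K s (d + 1) →ₗ[SRing K n] varPow K s (d + 1) × varPow K (insert a s) d where
  toFun x := (⟨X a * x.1, Ideal.mul_mem_left _ _ x.2⟩,
    ⟨-x.1, neg_mem (varPow_succ_le _ (varPow_le_insert _ x.2))⟩)
  map_add' x y := by
    refine Prod.ext (Subtype.ext ?_) (Subtype.ext ?_)
    · change X a * (x.1 + y.1) = X a * x.1 + X a * y.1
      ring
    · change -(x.1 + y.1) = -x.1 + -y.1
      ring
  map_smul' p x := by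
    refine Prod.ext (Subtype.ext ?_) (Subtype.ext ?_)
    · change X a * (p * x.1) = p * (X a * x.1)
      ring
    · change -(p * x.1) = p * -x.1
      ring

/-- The second map in the short exact sequence
`0 → P_s^(d+1)(-1) → P_s^(d+1) ⊕ P_t^d(-1) → P_t^(d+1) → 0` where `t = s ∪ {a}`. -/
def insertSnd (K : Type) [Field K] (a : Fin n) (s : Finset (Fin n)) (d : ℕ) :
    varPow K s (d + 1) × varPow K (insert a s) d →ₗ[SRing K n] varPow K (insert a s) (d + 1) where
  toFun x := ⟨x.1.1 + X a * x.2.1,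
    add_mem (varPow_le_insert _ x.1.2) (X_mul_mem_insert _ x.2.2)⟩
  map_add' x y := by
    refine Subtype.ext ?_
    change x.1.1 + y.1.1 + X a * (x.2.1 + y.2.1) = x.1.1 + X a * x.2.1 + (y.1.1 + X a * y.2.1)
    ring
  map_smul' p x := by
    refine Subtype.ext ?_
    change p * x.1.1 + X a * (p * x.2.1) = p * (x.1.1 + X a * x.2.1)
    ring

lemma insert_ses (ha : a ∉ s) :
    GradedSES ((ring K n).restrict (varPow K s (d + 1))).shift
      (((ring K n).restrict (varPow K s (d + 1))).prod
        ((ring K n).restrict (varPow K (insert a s) d)).shift)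
      ((ring K n).restrict (varPow K (insert a s) (d + 1)))
      (insertInl K a s d) (insertSnd K a s d) where
  inj x y h := by
    have := congrArg (fun z => z.2.1) h
    exact Subtype.ext (neg_injective this)
  surj c := by
    refine ⟨(⟨_, modMonomial_mem_varPow ha c.2⟩, ⟨_, divMonomial_mem_varPow c.2⟩), Subtype.ext ?_⟩
    exact modMonomial_add_divMonomial_single _ _
  exact := by
    rintro ⟨u, w⟩
    constructor
    · intro h
      have h' : u.1 + X a * w.1 = 0 := congrArg Subtype.val h
      have hu : X a * -w.1 = u.1 := by linear_combination -h'
      refine ⟨⟨-w.1, mem_of_X_mul_mem ha _ (by rw [hu]; exact u.2)⟩, ?_⟩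
      exact Prod.ext (Subtype.ext hu) (Subtype.ext (neg_neg _))
    · rintro ⟨x, hx⟩
      rw [← hx]
      refine Subtype.ext ?_
      change X a * x.1 + X a * -x.1 = 0
      ring
  mem_iff := by
    rintro (_ | N) x
    · constructor
      · intro h
        have h2 := congrArg Subtype.val h.2
        exact Subtype.ext (neg_eq_zero.1 h2)
      · intro h
        obtain rfl : x = 0 := h
        rw [map_zero]
        exact zero_mem _
    · constructor
      · intro h
        have h2 : -x.1 ∈ (ring K n).piece N := h.2
        exact neg_mem_iff.1 h2
      · intro h
        have hx : x.1 ∈ (ring K n).piece N := h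
        refine ⟨?_, ?_⟩
        · have := (ring K n).smul_mem (isHomogeneous_X K a) hx
          rwa [add_comm] at this
        · exact neg_mem hx
  map_mem := by
    rintro (_ | N) ⟨u, w⟩ ⟨hu, hw⟩
    · obtain rfl : w = 0 := hw
      have h0 : (insertSnd K a s d (u, 0)).1 = u.1 := by
        change u.1 + X a * 0 = u.1
        rw [mul_zero, add_zero]
      rw [mem_restrict, h0]
      exact hu
    · have hw' : X a * w.1 ∈ (ring K n).piece (1 + N) :=
        (ring K n).smul_mem (isHomogeneous_X K a) hw
      rw [add_comm] at hw'
      exact (ring K n).piece (N + 1) |>.add_mem hu hw'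
  lift := by
    intro N c hc
    refine ⟨(⟨_, modMonomial_mem_varPow ha c.2⟩, ⟨_, divMonomial_mem_varPow c.2⟩),
      ⟨modMonomial_isHomogeneous hc, ?_⟩,
      Subtype.ext (modMonomial_add_divMonomial_single _ _)⟩
    cases N with
    | zero =>
      refine Subtype.ext (MvPolynomial.ext _ _ fun e => ?_)
      by_contra he
      exact absurd (degree_of_coeff_divMonomial_ne_zero hc he) (Nat.succ_ne_zero _)
    | succ N =>
      exact isHomogeneous_of_degree fun e he =>
        Nat.succ_injective (degree_of_coeff_divMonomial_ne_zero hc he)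

end Insert

lemma lin_varPow_zero (r : ℕ) (s : Finset (Fin n)) :
    Lin r 0 ((ring K n).restrict (varPow K s 0)) := by
  cases r with
  | zero => trivial
  | succ r =>
    let φ : (Unit → SRing K n) →ₗ[SRing K n] varPow K s 0 :=
      (LinearMap.proj ()).codRestrict _ fun v e _ => Nat.zero_le _
    have : Subsingleton (LinearMap.ker φ) := by
      refine ⟨fun x y => Subtype.ext (funext fun _ => ?_)⟩
      exact (congrArg Subtype.val x.2).trans (congrArg Subtype.val y.2).symm
    refine ⟨Unit, inferInstance, fun _ => 0, φ, fun _ => le_rfl, fun x => ⟨fun _ => x, rfl⟩,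
      fun N v hv => ?_, fun N x hx => ⟨fun _ => x, fun l e he => ?_, rfl⟩, Lin.of_subsingleton _⟩
    · exact isHomogeneous_of_degree fun e he => by simpa using hv () e he
    · simpa using degree_eq_of_coeff_ne_zero hx he

lemma lin_varPow (r : ℕ) (s : Finset (Fin n)) :
    ∀ d, Lin r d ((ring K n).restrict (varPow K s d)) := by
  classical
  induction s using Finset.induction_on with
  | empty =>
    rintro (_ | d)
    · exact lin_varPow_zero r _
    · have : Subsingleton (varPow K (∅ : Finset (Fin n)) (d + 1)) := by
        refine ⟨fun x y => Subtype.ext (MvPolynomial.ext _ _ fun e => ?_)⟩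
        have h : ∀ z : varPow K (∅ : Finset (Fin n)) (d + 1), coeff e z.1 = 0 := by
          intro z
          by_contra hz
          have := z.2 e hz
          simp at this
        rw [h x, h y]
      exact Lin.of_subsingleton _
  | insert a s ha ih =>
    intro d
    induction d with
    | zero => exact lin_varPow_zero r _
    | succ d ihd => exact (insert_ses ha).lin_right (ih (d + 1)).shift ((ih (d + 1)).prod ihd.shift)

end OrderIdeal

section Resolution

variable {K : Type} [Field K] {n : ℕ}

open GradedPieces

/-- The projection of a graded free module onto its component of degree `N`. -/
def freeProj {ι : Type} (dg : ι → ℕ) (N : ℕ) : (ι → SRing K n) →+ (ι → SRing K n) where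
  toFun f l := if dg l ≤ N then homogeneousComponent (N - dg l) (f l) else 0
  map_zero' := by funext l; simp
  map_add' f g := by
    funext l
    by_cases h : dg l ≤ N <;> simp [h]

lemma coeff_freeProj {ι : Type} (dg : ι → ℕ) (N : ℕ) (f : ι → SRing K n) (l : ι)
    (e : Fin n →₀ ℕ) :
    coeff e (freeProj dg N f l) = if dg l + e.degree = N then coeff e (f l) else 0 := by
  change coeff e (if dg l ≤ N then homogeneousComponent (N - dg l) (f l) else 0) = _
  by_cases h : dg l ≤ N
  · rw [if_pos h, coeff_homogeneousComponent]
    congr 1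
    rw [eq_iff_iff]
    omega
  · rw [if_neg h, if_neg (by omega), coeff_zero]

lemma freeProj_mem {ι : Type} (dg : ι → ℕ) (N : ℕ) (f : ι → SRing K n) :
    freeProj dg N f ∈ (free dg).piece N := by
  intro l e h
  rw [coeff_freeProj] at h
  by_contra hne
  exact h (if_neg hne)

lemma freeProj_of_mem {ι : Type} {dg : ι → ℕ} {N' : ℕ} {f : ι → SRing K n}
    (hf : f ∈ (free dg).piece N') (N : ℕ) : freeProj dg N f = if N' = N then f else 0 := by
  funext l
  ext e
  rw [coeff_freeProj]
  by_cases h0 : coeff e (f l) = 0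
  · split_ifs <;> simp [h0]
  · rw [hf l e h0]
    split_ifs <;> simp

lemma sum_freeProj {ι : Type} [Fintype ι] (dg : ι → ℕ) (f : ι → SRing K n) :
    ∃ B₀, ∀ B ≥ B₀, ∑ N ∈ Finset.range B, freeProj dg N f = f := by
  classical
  refine ⟨∑ l, ∑ e ∈ (f l).support, (dg l + e.degree + 1), fun B hB => ?_⟩
  funext l
  ext e
  rw [Finset.sum_apply, coeff_sum]
  simp only [coeff_freeProj]
  rw [Finset.sum_ite_eq]
  by_cases h0 : coeff e (f l) = 0
  · rw [h0, ite_self]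
  · rw [if_pos]
    have h1 := Finset.single_le_sum (f := fun l => ∑ e ∈ (f l).support, (dg l + e.degree + 1))
      (fun _ _ => Nat.zero_le _) (Finset.mem_univ l)
    have h2 := Finset.single_le_sum (f := fun e => dg l + e.degree + 1)
      (fun _ _ => Nat.zero_le _) (mem_support_iff.2 h0)
    rw [Finset.mem_range]
    omega

section

variable {M : Type} [AddCommGroup M] [Module (SRing K n) M] {ι : Type} [Fintype ι] [DecidableEq ι]
  {𝒜 : GradedPieces K n M} {dg : ι → ℕ} {φ : (ι → SRing K n) →ₗ[SRing K n] M}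

lemma map_mem_of_single_mem (hφ : ∀ k, φ (Pi.single k 1) ∈ 𝒜.piece (dg k)) {N : ℕ}
    {f : ι → SRing K n} (hf : f ∈ (free dg).piece N) : φ f ∈ 𝒜.piece N := by
  have h : Fintype.linearCombination (SRing K n) (fun k => φ (Pi.single k 1)) = φ := by
    refine LinearMap.pi_ext' fun k => LinearMap.ext_ring ?_
    simp
  rw [← h]
  exact linearCombination_mem hφ hf

lemma map_freeProj (hφ : ∀ k, φ (Pi.single k 1) ∈ 𝒜.piece (dg k)) {π : ℕ → M →+ M}
    (hπ : ∀ N N' x, x ∈ 𝒜.piece N' → π N x = if N' = N then x else 0) (N : ℕ)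
    (f : ι → SRing K n) : φ (freeProj dg N f) = π N (φ f) := by
  obtain ⟨B, hB⟩ := sum_freeProj dg f
  rw [← hB B le_rfl]
  simp only [map_sum]
  refine Finset.sum_congr rfl fun N' _ => ?_
  rw [freeProj_of_mem (freeProj_mem dg N' f),
    hπ N N' _ (map_mem_of_single_mem hφ (freeProj_mem _ _ _))]
  split_ifs
  · rfl
  · rw [map_zero]

lemma exists_homogeneous_lift (hφ : ∀ k, φ (Pi.single k 1) ∈ 𝒜.piece (dg k)) {π : ℕ → M →+ M}
    (hπ : ∀ N N' x, x ∈ 𝒜.piece N' → π N x = if N' = N then x else 0) {N : ℕ} {x : M}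
    (hx : x ∈ 𝒜.piece N) (hr : x ∈ LinearMap.range φ) :
    ∃ f ∈ (free dg).piece N, φ f = x := by
  obtain ⟨f, rfl⟩ := hr
  exact ⟨freeProj dg N f, freeProj_mem _ _ _, by rw [map_freeProj hφ hπ, hπ N N _ hx, if_pos rfl]⟩

lemma freeProj_mem_ker (hφ : ∀ k, φ (Pi.single k 1) ∈ 𝒜.piece (dg k)) {π : ℕ → M →+ M}
    (hπ : ∀ N N' x, x ∈ 𝒜.piece N' → π N x = if N' = N then x else 0) (N : ℕ)
    {f : ι → SRing K n} (hf : f ∈ LinearMap.ker φ) : freeProj dg N f ∈ LinearMap.ker φ := by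
  rw [LinearMap.mem_ker, map_freeProj hφ hπ, LinearMap.mem_ker.1 hf, map_zero]

end

lemma homogeneousComponent_ring (N N' : ℕ) (p : SRing K n) (hp : p ∈ (ring K n).piece N') :
    (homogeneousComponent N : SRing K n →ₗ[K] SRing K n).toAddMonoidHom p =
      if N' = N then p else 0 := by
  simpa [eq_comm] using homogeneousComponent_of_mem (m := N) (n := N') hp

/-- A graded submodule of a graded free module of finite rank has a finite set of homogeneous
generators. -/
lemma exists_homogeneous_generators {ι : Type} [Fintype ι] (dg : ι → ℕ)
    (L : Submodule (SRing K n) (ι → SRing K n))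
    (hL : ∀ N, ∀ f ∈ L, freeProj dg N f ∈ L) :
    ∃ (κ : Type) (_ : Fintype κ) (_ : DecidableEq κ) (dg' : κ → ℕ)
      (ψ : (κ → SRing K n) →ₗ[SRing K n] L),
      Function.Surjective ψ ∧ ∀ k, ψ (Pi.single k 1) ∈ ((free dg).restrict L).piece (dg' k) := by
  classical
  obtain ⟨t, ht⟩ := IsNoetherian.noetherian L
  have htL : ∀ g ∈ t, g ∈ L := fun g hg => ht ▸ Submodule.subset_span hg
  choose B hB using fun g => sum_freeProj (K := K) (n := n) dg g
  let b : t × Fin (t.sup B) → L := fun k => ⟨freeProj dg k.2 k.1.1, hL _ _ (htL _ k.1.2)⟩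
  refine ⟨t × Fin (t.sup B), inferInstance, inferInstance, fun k => k.2,
    Fintype.linearCombination _ b, ?_, ?_⟩
  · have hb : ∀ k, b k ∈ LinearMap.range (Fintype.linearCombination (SRing K n) b) := fun k =>
      ⟨Pi.single k 1, by simp⟩
    have hle : L ≤ (LinearMap.range (Fintype.linearCombination (SRing K n) b)).map L.subtype := by
      conv_lhs => rw [← ht]
      rw [Submodule.span_le]
      intro g hg
      rw [← hB g _ (Finset.le_sup hg)]
      refine sum_mem fun N hN => ?_
      exact ⟨b (⟨g, hg⟩, ⟨N, Finset.mem_range.1 hN⟩), hb _, rfl⟩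
    intro x
    obtain ⟨y, ⟨z, hz⟩, hy⟩ := hle x.2
    exact ⟨z, hz.trans (Subtype.ext hy)⟩
  · intro k
    rw [Fintype.linearCombination_apply_single, one_smul]
    exact freeProj_mem _ _ _

/-- A graded free resolution of a graded module that is exact in the first `r` places, counting
the surjectivity of the augmentation as the first one. -/
structure FreeRes {M : Type} [AddCommGroup M] [Module (SRing K n) M] (𝒜 : GradedPieces K n M)
    (r : ℕ) where
  s : ℕ → ℕ
  dg : ∀ i, Fin (s i) → ℕ
  aug : (Fin (s 0) →₀ SRing K n) →ₗ[SRing K n] M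
  diff : ∀ i, (Fin (s (i + 1)) →₀ SRing K n) →ₗ[SRing K n] (Fin (s i) →₀ SRing K n)
  aug_mem : ∀ k, aug (Finsupp.single k 1) ∈ 𝒜.piece (dg 0 k)
  diff_mem : ∀ i k l e, coeff e ((diff i (Finsupp.single k 1)) l) ≠ 0 →
    dg i l + e.degree = dg (i + 1) k
  surj : 0 < r → Function.Surjective aug
  exact_zero : 1 < r → LinearMap.range (diff 0) = LinearMap.ker aug
  exact_succ : ∀ i : ℕ, i + 2 < r → LinearMap.range (diff (i + 1)) = LinearMap.ker (diff i)

namespace FreeRes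

variable {M : Type} [AddCommGroup M] [Module (SRing K n) M] {𝒜 : GradedPieces K n M}

/-- The zero complex, which is not required to be exact anywhere. -/
def nil (𝒜 : GradedPieces K n M) : FreeRes 𝒜 0 where
  s _ := 0
  dg _ k := k.elim0
  aug := 0
  diff _ := 0
  aug_mem k := k.elim0
  diff_mem _ k := k.elim0
  surj h := absurd h (lt_irrefl _)
  exact_zero h := absurd h (Nat.not_lt_zero _)
  exact_succ _ h := absurd h (Nat.not_lt_zero _)

/-- Functions on a finite type as finitely supported functions on an initial segment of `ℕ`. -/
def finEquiv (K : Type) [Field K] (n : ℕ) (ι : Type) [Fintype ι] :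
    (Fin (Fintype.card ι) →₀ SRing K n) ≃ₗ[SRing K n] (ι → SRing K n) :=
  Finsupp.linearEquivFunOnFinite (SRing K n) (SRing K n) _ ≪≫ₗ
    LinearEquiv.funCongrLeft (SRing K n) (SRing K n) (Fintype.equivFin ι)

lemma finEquiv_single {ι : Type} [Fintype ι] [DecidableEq ι] (k : Fin (Fintype.card ι)) :
    finEquiv K n ι (Finsupp.single k 1) = Pi.single ((Fintype.equivFin ι).symm k) 1 := by
  funext l
  change (Finsupp.single k (1 : SRing K n)) (Fintype.equivFin ι l) = _
  rw [Finsupp.single_apply, Pi.single_apply]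
  congr 1
  rw [eq_iff_iff, Equiv.eq_symm_apply, eq_comm]

variable {ι : Type} [Fintype ι] [DecidableEq ι] {r : ℕ}

/-- Splice a graded surjection from a free module with a resolution of its kernel. -/
def cons (dg : ι → ℕ) (φ : (ι → SRing K n) →ₗ[SRing K n] M)
    (hφ : ∀ k, φ (Pi.single k 1) ∈ 𝒜.piece (dg k)) (hs : Function.Surjective φ)
    (R : FreeRes ((free dg).restrict (LinearMap.ker φ)) r) : FreeRes 𝒜 (r + 1) where
  s i := Nat.casesOn i (Fintype.card ι) R.s
  dg i := match i with
    | 0 => fun k => dg ((Fintype.equivFin ι).symm k)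
    | i + 1 => R.dg i
  aug := φ ∘ₗ (finEquiv K n ι).toLinearMap
  diff i := match i with
    | 0 => (finEquiv K n ι).symm.toLinearMap ∘ₗ (LinearMap.ker φ).subtype ∘ₗ R.aug
    | i + 1 => R.diff i
  aug_mem k := by
    have := hφ ((Fintype.equivFin ι).symm k)
    rwa [← finEquiv_single] at this
  diff_mem i := match i with
    | 0 => fun k l e h => R.aug_mem k _ e h
    | i + 1 => R.diff_mem i
  surj _ := hs.comp (finEquiv K n ι).surjective
  exact_zero h := by
    ext x
    constructor
    · rintro ⟨y, rfl⟩
      rw [LinearMap.mem_ker]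
      change φ (finEquiv K n ι ((finEquiv K n ι).symm (R.aug y).1)) = 0
      rw [LinearEquiv.apply_symm_apply]
      exact (R.aug y).2
    · intro hx
      obtain ⟨y, hy⟩ := R.surj (by omega) ⟨finEquiv K n ι x, hx⟩
      refine ⟨y, ?_⟩
      change (finEquiv K n ι).symm (R.aug y).1 = x
      rw [hy, LinearEquiv.symm_apply_apply]
  exact_succ i := match i with
    | 0 => fun h => by
      change LinearMap.range (R.diff 0) = _
      rw [R.exact_zero (by omega)]
      ext x
      rw [LinearMap.mem_ker, LinearMap.mem_ker]
      change _ ↔ (finEquiv K n ι).symm (R.aug x).1 = 0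
      rw [LinearEquiv.map_eq_zero_iff, ZeroMemClass.coe_eq_zero]
    | i + 1 => fun h => R.exact_succ i (by omega)

/-- A resolution of an ideal as a graded module is a graded partial resolution. -/
def toGradedPartialRes {J : Ideal (SRing K n)} (R : FreeRes ((ring K n).restrict J) (r + 1)) :
    GradedPartialRes J (r : ℕ∞) where
  s := R.s
  dg := R.dg
  aug := J.subtype ∘ₗ R.aug
  diff := R.diff
  aug_hom := R.aug_mem
  diff_hom i k l := by
    by_cases h : (R.diff i (Finsupp.single k 1)) l = 0
    · exact Or.inl h
    · obtain ⟨e, he⟩ := exists_coeff_ne_zero h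
      have h1 := R.diff_mem i k l e he
      refine Or.inr ⟨e.degree, isHomogeneous_of_degree fun e' he' => ?_, h1⟩
      have := R.diff_mem i k l e' he'
      omega
  aug_range := by
    rw [LinearMap.range_comp, LinearMap.range_eq_top.2 (R.surj (Nat.succ_pos _)),
      Submodule.map_top, Submodule.range_subtype]
  exact_zero h := by
    rw [R.exact_zero (by have : 0 < r := by exact_mod_cast h
                         omega)]
    ext x
    rw [LinearMap.mem_ker, LinearMap.mem_ker]
    exact (ZeroMemClass.coe_eq_zero (x := R.aug x)).symm
  exact_succ i h := R.exact_succ i (by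
    have : i + 1 < r := by exact_mod_cast h
    omega)

end FreeRes

lemma Lin.exists_freeRes {r : ℕ} : ∀ {d : ℕ} {M : Type} [AddCommGroup M] [Module (SRing K n) M]
    {𝒜 : GradedPieces K n M}, Lin r d 𝒜 → ∃ R : FreeRes 𝒜 r, ∀ i k, R.dg i k ≤ d + i := by
  induction r with
  | zero => exact fun _ => ⟨FreeRes.nil _, fun _ k => k.elim0⟩
  | succ r ih =>
    classical
    rintro d M _ _ 𝒜 ⟨ι, hι, dg, φ, h1, h2, h3, h4, h5⟩
    obtain ⟨R, hR⟩ := ih h5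
    refine ⟨R.cons dg φ (fun k => h3 _ _ (single_mem_free _ _)) h2, ?_⟩
    rintro (_ | i) k
    · exact h1 _
    · have := hR i k
      change R.dg i k ≤ _
      omega

lemma gradedBetti_eq_zero {J : Ideal (SRing K n)} {i j : ℕ}
    (R : FreeRes ((ring K n).restrict J) (i + 1 + 1)) (h : ∀ k, R.dg i k ≠ j) :
    gradedBetti J i j = 0 := by
  refine le_antisymm (iInf_le_of_le (R.toGradedPartialRes) ?_) bot_le
  have : (Finset.univ.filter fun k => R.dg i k = j) = ∅ :=
    Finset.filter_eq_empty_iff.2 fun k _ => h k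
  change ((Finset.univ.filter fun k => R.dg i k = j).card : ℕ∞) ≤ 0
  rw [this]
  simp

lemma stepsLinear_of_lin {J : Ideal (SRing K n)} {d : ℕ}
    (h : ∀ r, Lin r d ((ring K n).restrict J)) (r : ℕ) : stepsLinear J d r := by
  intro i _ j hj
  obtain ⟨R, hR⟩ := (h (i + 1 + 1)).exists_freeRes
  refine gradedBetti_eq_zero R fun k hk => ?_
  have := hR i k
  omega

/-- An ideal generated by finitely many forms of degree `d` is `0` steps linear. -/
lemma stepsLinear_zero_of_span {T : Set (SRing K n)} (hT : T.Finite) {d : ℕ}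
    (hd : ∀ p ∈ T, p.IsHomogeneous d) : stepsLinear (Ideal.span T) d 0 := by
  classical
  intro i hi j hj
  obtain rfl : i = 0 := Nat.le_zero.1 hi
  have := hT.fintype
  let g : T → Ideal.span T := fun p => ⟨p.1, Ideal.subset_span p.2⟩
  let φ : (T → SRing K n) →ₗ[SRing K n] Ideal.span T := Fintype.linearCombination _ g
  have hφ : ∀ k, φ (Pi.single k 1) ∈ ((ring K n).restrict (Ideal.span T)).piece d := by
    intro k
    rw [Fintype.linearCombination_apply_single, one_smul]
    exact hd _ k.2
  have hs : Function.Surjective φ := by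
    have hle : Ideal.span T ≤ (LinearMap.range φ).map (Ideal.span T).subtype := by
      refine Submodule.span_le.2 fun p hp => ?_
      exact ⟨g ⟨p, hp⟩, ⟨Pi.single ⟨p, hp⟩ 1, by simp [φ]⟩, rfl⟩
    intro x
    obtain ⟨y, ⟨z, hz⟩, hy⟩ := hle x.2
    exact ⟨z, hz.trans (Subtype.ext hy)⟩
  have hker : LinearMap.ker φ = LinearMap.ker ((Ideal.span T).subtype ∘ₗ φ) := by
    rw [LinearMap.ker_comp_of_ker_eq_bot _ (Submodule.ker_subtype _)]
  obtain ⟨κ, hκ, hκ', dg', ψ, hψ, hψm⟩ := exists_homogeneous_generators (fun _ : T => d)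
    (LinearMap.ker φ) (fun N f hf => by
      rw [hker] at hf ⊢
      exact freeProj_mem_ker (𝒜 := ring K n) hφ homogeneousComponent_ring N hf)
  let R := FreeRes.cons (fun _ => d) φ hφ hs (FreeRes.cons dg' ψ hψm hψ (FreeRes.nil _))
  refine gradedBetti_eq_zero R fun k => ?_
  have : R.dg 0 k = d := rfl
  omega

end Resolution

section Syzygy

variable {K : Type} [Field K] {n : ℕ}

open GradedPieces

lemma mul_mem_of_no_generator {ι κ : Type} [Fintype ι] [DecidableEq ι] [Fintype κ] [DecidableEq κ]
    {d₀ : ι → ℕ} {d₁ : κ → ℕ} {φ : (ι → SRing K n) →ₗ[SRing K n] SRing K n}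
    {δ : (κ → SRing K n) →ₗ[SRing K n] (ι → SRing K n)}
    (hφ : ∀ k, φ (Pi.single k 1) ∈ (ring K n).piece (d₀ k))
    (hδ : ∀ k, δ (Pi.single k 1) ∈ (free d₀).piece (d₁ k))
    (hex : LinearMap.range δ = LinearMap.ker φ) {m : ℕ} (hd : ∀ k, d₁ k ≠ m + 2)
    {u w : SRing K n} (hu : u ∈ LinearMap.range φ) (hw : w ∈ LinearMap.range φ)
    (hum : u.IsHomogeneous m) (hwm : w.IsHomogeneous m) {a b : Fin n} (hab : a ≠ b)
    (huw : X b ^ 2 * u = X a ^ 2 * w) :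
    X b * u ∈ varPow K (Finset.univ.erase b) 1 * LinearMap.range φ := by
  obtain ⟨e₁, h₁m, h₁⟩ := exists_homogeneous_lift hφ homogeneousComponent_ring hum hu
  obtain ⟨e₂, h₂m, h₂⟩ := exists_homogeneous_lift hφ homogeneousComponent_ring hwm hw
  have hsq : ∀ c : Fin n, (X c ^ 2 : SRing K n).IsHomogeneous 2 := fun c => by
    simpa using (isHomogeneous_X K c).pow 2
  have hz : (X b : SRing K n) ^ 2 • e₁ - (X a : SRing K n) ^ 2 • e₂ ∈ (free d₀).piece (m + 2) := by
    rw [add_comm]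
    exact sub_mem ((free d₀).smul_mem (hsq b) h₁m) ((free d₀).smul_mem (hsq a) h₂m)
  have hzr : (X b : SRing K n) ^ 2 • e₁ - (X a : SRing K n) ^ 2 • e₂ ∈ LinearMap.range δ := by
    rw [hex, LinearMap.mem_ker, map_sub, map_smul, map_smul, h₁, h₂, smul_eq_mul, smul_eq_mul,
      huw, sub_self]
  obtain ⟨y, hym, hy⟩ := exists_homogeneous_lift hδ
    (fun N N' x hx => freeProj_of_mem hx N) hz hzr
  set P := varPow K (Finset.univ.erase b) 1 with hP
  have hb : b ∉ Finset.univ.erase b := Finset.notMem_erase _ _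
  have hyP : ∀ k, y k ∈ varPow K (insert b (Finset.univ.erase b)) 1 := by
    intro k
    refine mem_varPow.2 fun e he => ?_
    rw [Finset.insert_erase (Finset.mem_univ b), Nat.one_le_iff_ne_zero]
    intro h0
    have h1 := hym k e he
    have h2 : e.degree = 0 := by rw [Finsupp.degree_eq_sum]; exact h0
    exact hd k (by omega)
  have haP : (X a : SRing K n) ∈ P := by
    refine mem_varPow.2 fun e he => ?_
    rw [coeff_X] at he
    have : Finsupp.single a 1 = e := by
      by_contra hne
      exact he (if_neg hne)
    rw [← this]
    refine le_trans ?_ (Finset.single_le_sum (fun _ _ => Nat.zero_le _)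
      (Finset.mem_erase.2 ⟨hab, Finset.mem_univ a⟩))
    simp
  let q : κ → SRing K n := fun k => divMonomial (y k) (Finsupp.single b 1)
  let t : κ → SRing K n := fun k => modMonomial (y k) (Finsupp.single b 1)
  have ht : ∀ k, t k ∈ P := fun k => modMonomial_mem_varPow hb (hyP k)
  have hyqt : y = (X b : SRing K n) • q + t := by
    funext k
    exact (divMonomial_add_modMonomial_single (y k) b).symm
  have hmapδ : ∀ l, δ t l ∈ P := by
    intro l
    rw [← LinearMap.sum_single_apply (fun _ => SRing K n) t, map_sum, Finset.sum_apply]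
    refine sum_mem fun k _ => ?_
    have : Pi.single k (t k) = t k • (Pi.single k 1 : κ → SRing K n) := by
      rw [← Pi.single_smul, smul_eq_mul, mul_one]
    rw [this, map_smul]
    exact Ideal.mul_mem_right _ _ (ht k)
  have hc : ∀ l, (δ q - (X b : SRing K n) • e₁) l ∈ P := by
    intro l
    refine mem_of_X_mul_mem hb _ ?_
    have h : X b * (δ q - (X b : SRing K n) • e₁) l = -(X a * (X a * e₂ l)) - δ t l := by
      have := congrFun hy l
      rw [hyqt, map_add, map_smul] at this
      simp only [Pi.add_apply, Pi.sub_apply, Pi.smul_apply, smul_eq_mul] at this ⊢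
      linear_combination this
    rw [h]
    exact sub_mem (neg_mem (Ideal.mul_mem_right _ _ haP)) (hmapδ l)
  have hδq : φ (δ q) = 0 := by
    rw [← LinearMap.mem_ker, ← hex]
    exact ⟨q, rfl⟩
  have hfin : X b * u = -φ (δ q - (X b : SRing K n) • e₁) := by
    rw [map_sub, hδq, map_smul, h₁, smul_eq_mul]
    ring
  rw [hfin]
  refine neg_mem ?_
  generalize δ q - (X b : SRing K n) • e₁ = c at hc
  rw [← LinearMap.sum_single_apply (fun _ => SRing K n) c, map_sum]
  refine sum_mem fun l _ => ?_
  have : Pi.single l (c l) = c l • (Pi.single l 1 : ι → SRing K n) := by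
    rw [← Pi.single_smul, smul_eq_mul, mul_one]
  rw [this, map_smul]
  exact Ideal.mul_mem_mul (hc l) ⟨_, rfl⟩

lemma linearEquivFunOnFinite_symm_single {s : ℕ} (k : Fin s) :
    (Finsupp.linearEquivFunOnFinite (SRing K n) (SRing K n) (Fin s)).symm (Pi.single k 1) =
      Finsupp.single k 1 := by
  rw [LinearEquiv.symm_apply_eq]
  funext l
  simp [Finsupp.single_apply, Pi.single_apply, eq_comm]

/-- If a monomial-type syzygy `X b ^ 2 * u = X a ^ 2 * w` between forms of degree `m` is not a
consequence of syzygies of smaller degree, then the ideal has a nonlinear first syzygy. -/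
lemma gradedBetti_one_ne_zero {J : Ideal (SRing K n)} {m : ℕ} {u w : SRing K n} (hu : u ∈ J)
    (hw : w ∈ J) (hum : u.IsHomogeneous m) (hwm : w.IsHomogeneous m) {a b : Fin n} (hab : a ≠ b)
    (huw : X b ^ 2 * u = X a ^ 2 * w)
    (hnot : X b * u ∉ varPow K (Finset.univ.erase b) 1 * J) : gradedBetti J 1 (m + 2) ≠ 0 := by
  intro h0
  rw [gradedBetti, ENat.iInf_eq_zero] at h0
  obtain ⟨R, hR⟩ := h0
  have hd : ∀ k, R.dg 1 k ≠ m + 2 := by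
    rw [Nat.cast_eq_zero, Finset.card_eq_zero, Finset.filter_eq_empty_iff] at hR
    exact fun k => hR (Finset.mem_univ k)
  let E := fun s : ℕ => Finsupp.linearEquivFunOnFinite (SRing K n) (SRing K n) (Fin s)
  let φ := R.aug ∘ₗ (E (R.s 0)).symm.toLinearMap
  let δ := (E (R.s 0)).toLinearMap ∘ₗ R.diff 0 ∘ₗ (E (R.s 1)).symm.toLinearMap
  have hφr : LinearMap.range φ = J := by
    rw [LinearMap.range_comp_of_range_eq_top _ (LinearEquiv.range _), R.aug_range]
  have hφ : ∀ k, φ (Pi.single k 1) ∈ (ring K n).piece (R.dg 0 k) := by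
    intro k
    change R.aug ((E (R.s 0)).symm (Pi.single k 1)) ∈ _
    rw [linearEquivFunOnFinite_symm_single]
    exact R.aug_hom k
  have hδ : ∀ k, δ (Pi.single k 1) ∈ (free (R.dg 0)).piece (R.dg 1 k) := by
    intro k
    change (E (R.s 0)) (R.diff 0 ((E (R.s 1)).symm (Pi.single k 1))) ∈ _
    rw [linearEquivFunOnFinite_symm_single]
    intro l e he
    change coeff e (R.diff 0 (Finsupp.single k 1) l) ≠ 0 at he
    rcases R.diff_hom 0 k l with h | ⟨m, h, hm⟩
    · rw [h, coeff_zero] at he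
      exact absurd rfl he
    · rw [degree_eq_of_coeff_ne_zero h he, hm]
  have hex : LinearMap.range δ = LinearMap.ker φ := by
    have h := R.exact_zero (by norm_num)
    ext x
    constructor
    · rintro ⟨y, rfl⟩
      change R.aug ((E (R.s 0)).symm (E (R.s 0) (R.diff 0 ((E (R.s 1)).symm y)))) = 0
      rw [LinearEquiv.symm_apply_apply, ← LinearMap.mem_ker, ← h]
      exact ⟨_, rfl⟩
    · intro hx
      have hx' : (E (R.s 0)).symm x ∈ LinearMap.ker R.aug := hx
      rw [← h] at hx'
      obtain ⟨y, hy⟩ := hx'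
      refine ⟨E (R.s 1) y, ?_⟩
      change E (R.s 0) (R.diff 0 ((E (R.s 1)).symm (E (R.s 1) y))) = x
      rw [LinearEquiv.symm_apply_apply, hy, LinearEquiv.apply_symm_apply]
  have := mul_mem_of_no_generator hφ hδ hex hd (by rw [hφr]; exact hu) (by rw [hφr]; exact hw)
    hum hwm hab huw
  rw [hφr] at this
  exact hnot this

end Syzygy

section LoopGraph

variable {K : Type} [Field K] {n : ℕ}

open GradedPieces
open scoped Pointwise

lemma isHomogeneous_of_mem_pow {T : Set (SRing K n)} {d : ℕ} (hT : ∀ p ∈ T, p.IsHomogeneous d)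
    (k : ℕ) : ∀ p ∈ T ^ k, p.IsHomogeneous (d * k) := by
  induction k with
  | zero =>
    intro p hp
    rw [pow_zero, Set.mem_one] at hp
    subst hp
    exact isHomogeneous_one _ _
  | succ k ih =>
    intro p hp
    rw [pow_succ] at hp
    obtain ⟨u, hu, w, hw, rfl⟩ := Set.mem_mul.1 hp
    exact (ih u hu).mul (hT w hw)

lemma stepsLinear_zero_edgeIdeal_pow (E : Fin n → Fin n → Prop) (k : ℕ) :
    stepsLinear (edgeIdeal K E ^ k) (2 * k) 0 := by
  have hT : {p : SRing K n | ∃ i j, E i j ∧ p = X i * X j}.Finite := by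
    refine (Set.finite_range fun z : Fin n × Fin n => (X z.1 * X z.2 : SRing K n)).subset ?_
    rintro p ⟨i, j, -, rfl⟩
    exact ⟨(i, j), rfl⟩
  have hspan : edgeIdeal K E ^ k =
      Ideal.span ({p : SRing K n | ∃ i j, E i j ∧ p = X i * X j} ^ k) :=
    Submodule.span_pow _ k
  have hTk : ({p : SRing K n | ∃ i j, E i j ∧ p = X i * X j} ^ k).Finite := by
    induction k with
    | zero =>
      rw [pow_zero]
      exact Set.finite_one
    | succ k ih =>
      rw [pow_succ]
      exact (ih (Submodule.span_pow _ k)).mul hT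
  rw [hspan]
  refine stepsLinear_zero_of_span hTk (isHomogeneous_of_mem_pow ?_ k)
  rintro p ⟨i, j, -, rfl⟩
  exact (isHomogeneous_X K i).mul (isHomogeneous_X K j)

lemma idealOfVars_pow_eq_varPow (d : ℕ) :
    idealOfVars (Fin n) K ^ d = varPow K Finset.univ d := by
  ext p
  rw [mem_pow_idealOfVars_iff, mem_varPow]
  simp only [mem_support_iff, Finsupp.degree_eq_sum]

lemma edgeIdeal_eq_idealOfVars_sq {E : Fin n → Fin n → Prop} (hE : ∀ a b, E a b) :
    edgeIdeal K E = idealOfVars (Fin n) K ^ 2 := by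
  rw [idealOfVars, sq, Ideal.span_mul_span']
  refine congrArg Ideal.span (Set.ext fun p => ?_)
  constructor
  · rintro ⟨i, j, -, rfl⟩
    exact Set.mul_mem_mul ⟨i, rfl⟩ ⟨j, rfl⟩
  · intro hp
    obtain ⟨-, ⟨i, rfl⟩, -, ⟨j, rfl⟩, rfl⟩ := Set.mem_mul.1 hp
    exact ⟨i, j, hE i j, rfl⟩

lemma idealIndex_eq_top {J : Ideal (SRing K n)} {d : ℕ} (h : ∀ r, stepsLinear J d r) :
    idealIndex J d = ⊤ := by
  refine ENat.eq_top_iff_forall_ge.2 fun m => ?_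
  exact le_self_add.trans (le_sSup (a := (m : ℕ∞) + 1) ⟨m, rfl, h m⟩)

lemma idealIndex_eq_one {J : Ideal (SRing K n)} {d : ℕ} (h0 : stepsLinear J d 0)
    (h1 : ¬ stepsLinear J d 1) : idealIndex J d = 1 := by
  refine le_antisymm (sSup_le ?_) (le_sSup ⟨0, by simp, h0⟩)
  rintro - ⟨r, rfl, hr⟩
  obtain rfl : r = 0 := by
    by_contra hne
    exact h1 fun i hi => hr i (by omega)
  simp

lemma idealIndex_complete {E : Fin n → Fin n → Prop} (hE : ∀ a b, E a b) (k : ℕ) :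
    idealIndex (edgeIdeal K E ^ k) (2 * k) = ⊤ := by
  rw [edgeIdeal_eq_idealOfVars_sq hE, ← pow_mul, idealOfVars_pow_eq_varPow]
  exact idealIndex_eq_top (stepsLinear_of_lin fun r => lin_varPow r _ _)

/-- The order function counting how many edges of the loop graph of the complete graph without the
edge `ab` can divide a monomial. -/
def gapOrder (a b : Fin n) (e : Fin n →₀ ℕ) : ℕ :=
  e a / 2 + e b / 2 + ∑ i ∈ (Finset.univ.erase a).erase b, e i

lemma gapOrder_add_le (a b : Fin n) (u w : Fin n →₀ ℕ) :
    gapOrder a b u + gapOrder a b w ≤ gapOrder a b (u + w) := by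
  simp only [gapOrder, Finsupp.add_apply, Finset.sum_add_distrib]
  omega

lemma one_le_gapOrder {a b : Fin n} {i j : Fin n} (h : ¬ (i = a ∧ j = b))
    (h' : ¬ (i = b ∧ j = a)) :
    1 ≤ gapOrder a b (Finsupp.single i 1 + Finsupp.single j 1) := by
  have hout : ∀ c, c ≠ a → c ≠ b → ∀ e : Fin n →₀ ℕ, 1 ≤ e c → 1 ≤ gapOrder a b e := by
    intro c hca hcb e he
    have := Finset.single_le_sum (f := fun i => e i) (fun _ _ => Nat.zero_le _)
      (Finset.mem_erase.2 ⟨hcb, Finset.mem_erase.2 ⟨hca, Finset.mem_univ c⟩⟩)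
    rw [gapOrder]
    omega
  by_cases hi : i = a ∨ i = b
  · by_cases hj : j = a ∨ j = b
    · obtain rfl : i = j := by grind
      rcases hi with rfl | rfl
      · simp [gapOrder]; omega
      · simp [gapOrder]; omega
    · push Not at hj
      exact hout j hj.1 hj.2 _ (by simp)
  · push Not at hi
    exact hout i hi.1 hi.2 _ (by simp)

lemma edgeIdeal_le_orderIdeal {E : Fin n → Fin n → Prop} {a b : Fin n} (hab : ¬ E a b)
    (hba : ¬ E b a) : edgeIdeal K E ≤ orderIdeal K (gapOrder a b) (gapOrder_add_le a b) 1 := by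
  refine Ideal.span_le.2 ?_
  rintro p ⟨i, j, hij, rfl⟩
  refine mem_orderIdeal.2 fun e he => ?_
  obtain ⟨u, rfl, hu⟩ := coeff_X_mul_ne_zero he
  rw [coeff_X] at hu
  have hu' : Finsupp.single j 1 = u := by
    by_contra hne
    exact hu (if_neg hne)
  rw [← hu', add_comm]
  exact one_le_gapOrder (by rintro ⟨rfl, rfl⟩; exact hab hij) (by rintro ⟨rfl, rfl⟩; exact hba hij)

lemma X_mul_X_pow_notMem {J : Ideal (SRing K n)} {a b : Fin n} (hab : a ≠ b) {k : ℕ}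
    (hJ : J ≤ orderIdeal K (gapOrder a b) (gapOrder_add_le a b) k) :
    X b * X a ^ (2 * k) ∉ varPow K (Finset.univ.erase b) 1 * J := by
  intro hmem
  have hkey : ∀ p ∈ varPow K (Finset.univ.erase b) 1 * J,
      coeff (Finsupp.single a (2 * k) + Finsupp.single b 1) p = 0 := by
    intro p hp
    refine Submodule.mul_induction_on hp (fun p hp q hq => ?_) fun p q hp hq => by
      rw [coeff_add, hp, hq, add_zero]
    by_contra hne
    obtain ⟨u, w, huw, hu, hw⟩ := coeff_mul_ne_zero hne
    have h1 := mem_varPow.1 hp u hu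
    have h2 := mem_orderIdeal.1 (hJ hq) w hw
    have hc : ∀ c, u c + w c =
        (Finsupp.single a (2 * k) + Finsupp.single b 1 : Fin n →₀ ℕ) c := fun c => by
      rw [← huw, Finsupp.add_apply]
    have ha : u a + w a = 2 * k := by simpa [hab.symm, hab] using hc a
    have hb : u b + w b = 1 := by simpa [hab.symm, hab] using hc b
    have ho : ∀ c ∈ (Finset.univ.erase a).erase b, u c + w c = 0 := by
      intro c hcm
      have hcb := Finset.ne_of_mem_erase hcm
      have hca := Finset.ne_of_mem_erase (Finset.mem_of_mem_erase hcm)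
      simpa [hca.symm, hcb.symm, Finsupp.single_apply] using hc c
    have hu0 : ∑ c ∈ (Finset.univ.erase a).erase b, u c = 0 :=
      Finset.sum_eq_zero fun c hcm => (Nat.add_eq_zero_iff.1 (ho c hcm)).1
    have hw0 : ∑ c ∈ (Finset.univ.erase a).erase b, w c = 0 :=
      Finset.sum_eq_zero fun c hcm => (Nat.add_eq_zero_iff.1 (ho c hcm)).2
    rw [← Finset.add_sum_erase _ _ (Finset.mem_erase.2 ⟨hab, Finset.mem_univ a⟩),
      Finset.erase_right_comm, hu0] at h1
    rw [gapOrder, hw0] at h2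
    omega
  have := hkey _ hmem
  rw [mul_comm (X b), coeff_mul_X, coeff_X_pow, if_pos rfl] at this
  exact one_ne_zero this

lemma idealIndex_not_complete {E : Fin n → Fin n → Prop} (hloop : ∀ a, E a a) {a b : Fin n}
    (hne : a ≠ b) (hab : ¬ E a b) (hba : ¬ E b a) {k : ℕ} (hk : 1 ≤ k) :
    idealIndex (edgeIdeal K E ^ k) (2 * k) = 1 := by
  refine idealIndex_eq_one (stepsLinear_zero_edgeIdeal_pow E k) fun h => ?_
  obtain ⟨l, rfl⟩ : ∃ l, k = l + 1 := ⟨k - 1, by omega⟩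
  have hsq : ∀ c : Fin n, (X c ^ 2 : SRing K n) ∈ edgeIdeal K E := fun c =>
    Ideal.subset_span ⟨c, c, hloop c, sq _⟩
  have hu : (X a ^ (2 * (l + 1)) : SRing K n) ∈ edgeIdeal K E ^ (l + 1) := by
    rw [pow_mul]
    exact Ideal.pow_mem_pow (hsq a) _
  have hw : ((X a ^ 2) ^ l * X b ^ 2 : SRing K n) ∈ edgeIdeal K E ^ (l + 1) := by
    rw [pow_succ]
    exact Ideal.mul_mem_mul (Ideal.pow_mem_pow (hsq a) _) (hsq b)
  have hhom : ∀ c : Fin n, (X c ^ 2 : SRing K n).IsHomogeneous 2 := fun c => by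
    simpa using (isHomogeneous_X K c).pow 2
  refine gradedBetti_one_ne_zero hu hw (m := 2 * (l + 1)) ?_ ?_ hne (by ring)
    (X_mul_X_pow_notMem hne (pow_le_orderIdeal (edgeIdeal_le_orderIdeal hab hba) _)) ?_
  · simpa using (isHomogeneous_X K a).pow (2 * (l + 1))
  · exact ((hhom a).pow l).mul (hhom b)
  · have := h 1 le_rfl (2 * (l + 1) + 1) (Nat.lt_succ_self _)
    rwa [show 1 + (2 * (l + 1) + 1) = 2 * (l + 1) + 2 by ring] at this

end LoopGraph

/-- For the loop graph `L(G)` of a simple graph `G`, all powers of `I(L(G))` have a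
linear resolution iff `G` is complete, and all powers have index `1` iff `G` is
not complete. -/
theorem stmt6 (K : Type) [Field K] (n : ℕ) (G : SimpleGraph (Fin n))
    (I : Ideal (SRing K n))
    (hI : I = edgeIdeal K (fun a b => G.Adj a b ∨ a = b)) :
    ((∀ k : ℕ, 1 ≤ k → idealIndex (I ^ k) (2*k) = ⊤) ↔
      (∀ a b : Fin n, a ≠ b → G.Adj a b)) ∧
    ((∀ k : ℕ, 1 ≤ k → idealIndex (I ^ k) (2*k) = 1) ↔
      ¬ (∀ a b : Fin n, a ≠ b → G.Adj a b)) := by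
  have htop : (∀ a b : Fin n, a ≠ b → G.Adj a b) → ∀ k, idealIndex (I ^ k) (2 * k) = ⊤ := by
    intro hG k
    rw [hI]
    refine idealIndex_complete (fun a b => ?_) k
    by_cases hab : a = b
    · exact Or.inr hab
    · exact Or.inl (hG a b hab)
  have hone : ¬ (∀ a b : Fin n, a ≠ b → G.Adj a b) →
      ∀ k, 1 ≤ k → idealIndex (I ^ k) (2 * k) = 1 := by
    intro hG k hk
    push Not at hG
    obtain ⟨a, b, hne, hab⟩ := hG
    rw [hI]
    refine idealIndex_not_complete (fun _ => Or.inr rfl) hne ?_ ?_ hk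
    · rintro (h | h)
      exacts [hab h, hne h]
    · rintro (h | h)
      exacts [hab h.symm, hne h.symm]
  refine ⟨⟨fun h => ?_, fun hG k _ => htop hG k⟩, ⟨fun h hG => ?_, hone⟩⟩
  · by_contra hG
    exact ENat.one_ne_top ((hone hG 1 le_rfl).symm.trans (h 1 le_rfl))
  · exact ENat.one_ne_top ((h 1 le_rfl).symm.trans (htop hG 1))

end
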